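/- There exists an absolute constant c > 0 with the following property. Let G be an abelian group, A a finite nonempty subset of G, D = A − A, S = A + A, and set K := |A|³/E(A). Let β, γ ∈ (0,1] with β ≤ 1/2. Suppose that A is (3,β,γ)-connected and E₃(A) ≥ 2⁴·γ⁻¹·|A|³. Then there exist nonzero x, y ∈ G such that |D ∩ (D − x)| ≥ c·γ^{1/2}·K^{1/2}·|A| and |S ∩ (S − y)| ≥ c·γ^{1/2}·K^{1/2}·|A|. -/

import Mathlib

open Finset Pointwise

universe u

variable {G : Type*} [AddCommGroup G] [DecidableEq G]

/-- `A_s = A ∩ (A - s) = {x ∈ A : x + s ∈ A}`. -/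
def stab (A : Finset G) (s : G) : Finset G := A ∩ A.image (fun a => a - s)

/-- `E_k(A) = ∑_{s ∈ G} |A_s|^k` (the summand vanishes off `A - A`). -/
def energyK (k : ℕ) (A : Finset G) : ℕ := ∑ s ∈ A - A, (stab A s).card ^ k

/-- The additive energy `E(A)`. -/
def energy (A : Finset G) : ℕ := energyK 2 A

/-- `(k, β, γ)`-connectedness: every `B ⊆ A` with `|B| ≥ β|A|` satisfies
`E_k(B) ≥ γ (|B|/|A|)^{2k} E_k(A)`. -/
def conn (k : ℕ) (β γ : ℝ) (A : Finset G) : Prop :=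
  ∀ B ⊆ A, β * (A.card : ℝ) ≤ (B.card : ℝ) →
    γ * ((B.card : ℝ) / (A.card : ℝ)) ^ (2 * k) * (energyK k A : ℝ) ≤ (energyK k B : ℝ)

theorem mem_stab' {G : Type*} [AddCommGroup G] [DecidableEq G] (A : Finset G) (s x : G) :
    x ∈ stab A s ↔ x ∈ A ∧ x + s ∈ A := by
  unfold stab
  simp only [mem_inter, mem_image]
  constructor
  · rintro ⟨h, a, ha, rfl⟩
    exact ⟨h, by simpa using ha⟩
  · rintro ⟨h, h2⟩
    exact ⟨h, _, h2, by simp⟩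

theorem stab_eq_filter {G : Type*} [AddCommGroup G] [DecidableEq G] (A : Finset G) (s : G) :
    stab A s = A.filter (fun x => x + s ∈ A) := by
  ext x; rw [mem_stab', mem_filter]

theorem stab_neg_card {G : Type*} [AddCommGroup G] [DecidableEq G] (A : Finset G) (s : G) :
    (stab A (-s)).card = (stab A s).card := by
  apply Finset.card_bij (fun x _ => x - s)
  · intro x hx
    rw [mem_stab'] at hx ⊢
    refine ⟨by simpa [sub_eq_add_neg] using hx.2, by simpa using hx.1⟩
  · intro a _ b _ h
    simpa using h
  · intro x hx
    rw [mem_stab'] at hx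
    exact ⟨x + s, by rw [mem_stab']; simpa using hx.symm, by simp⟩

theorem sum_stab {G : Type*} [AddCommGroup G] [DecidableEq G] (B : Finset G) (F : G → G → ℝ) :
    ∑ s ∈ B - B, ∑ c ∈ stab B s, F s c = ∑ c ∈ B, ∑ d ∈ B, F (d - c) c := by
  rw [Finset.sum_sigma', Finset.sum_sigma']
  apply Finset.sum_bij' (fun p _ => (⟨p.2, p.2 + p.1⟩ : Σ _ : G, G))
    (fun p _ => (⟨p.2 - p.1, p.1⟩ : Σ _ : G, G))
  · rintro ⟨s, c⟩ h
    simp only [mem_sigma, mem_stab'] at h ⊢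
    exact h.2
  · rintro ⟨c, d⟩ h
    simp only [mem_sigma, mem_stab'] at h ⊢
    exact ⟨sub_mem_sub h.2 h.1, h.1, by simpa using h.2⟩
  · rintro ⟨s, c⟩ h
    simp
  · rintro ⟨c, d⟩ h
    simp
  · rintro ⟨s, c⟩ h
    simp

theorem sum_sub_eq {G : Type*} [AddCommGroup G] [DecidableEq G] (B : Finset G) (f : G → ℝ) :
    ∑ c ∈ B, ∑ d ∈ B, f (d - c) = ∑ s ∈ B - B, ((stab B s).card : ℝ) * f s := by
  rw [← sum_stab B (fun s _ => f s)]
  simp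

theorem energy_stab {G : Type*} [AddCommGroup G] [DecidableEq G] (B C : Finset G) :
    (addEnergy B C : ℝ) = ∑ c ∈ C, ∑ d ∈ C, ((stab B (c - d)).card : ℝ) := by
  have : addEnergy B C = ∑ c ∈ C, ∑ d ∈ C, (stab B (c - d)).card := by
    rw [← Finset.sum_product', ← Finset.card_sigma]
    unfold addEnergy
    apply Finset.card_bij' (fun p _ => (⟨(p.2.1, p.2.2), p.1.1⟩ : Σ _ : G × G, G))
      (fun p _ => ((p.2, p.2 + (p.1.1 - p.1.2)), (p.1.1, p.1.2)))
    · rintro ⟨⟨a, b⟩, c, d⟩ h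
      simp only [mem_filter, mem_product, mem_sigma, mem_stab'] at h ⊢
      have : a + (c - d) = b := by rw [← add_sub_assoc, h.2]; simp
      rw [this]; tauto
    · rintro ⟨⟨c, d⟩, a⟩ h
      simp only [mem_filter, mem_product, mem_sigma, mem_stab'] at h ⊢
      refine ⟨by tauto, by abel⟩
    · rintro ⟨⟨a, b⟩, c, d⟩ h
      simp only [mem_filter, mem_product] at h
      have : a + (c - d) = b := by rw [← add_sub_assoc, h.2]; simp
      simp [this]
    · rintro ⟨⟨c, d⟩, a⟩ h
      simp
  rw [this]; push_cast; rfl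

theorem sub_energy {G : Type*} [AddCommGroup G] [DecidableEq G] (B C : Finset G) :
    (B.card : ℝ) ^ 2 * (C.card : ℝ) ^ 2 ≤ ((B - C).card : ℝ) * (addEnergy B C : ℝ) := by
  have h1 : (addEnergy B (-C) : ℝ) = addEnergy B C := by
    rw [energy_stab, energy_stab]
    have hn : ∀ f : G → ℝ, ∑ c ∈ -C, f c = ∑ c ∈ C, f (-c) := by
      intro f
      rw [← Finset.image_neg_eq_neg, Finset.sum_image (by simp)]
    simp only [hn]
    apply Finset.sum_congr rfl
    intro c _
    apply Finset.sum_congr rfl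
    intro d _
    rw [← stab_neg_card B (c - d)]
    congr 3
    abel
  have h2 : (B.card : ℝ) ^ 2 * ((-C).card : ℝ) ^ 2
      ≤ ((B + -C).card : ℝ) * (addEnergy B (-C) : ℝ) := by
    exact_mod_cast Finset.le_card_add_mul_addEnergy B (-C)
  rw [h1, ← sub_eq_add_neg, Finset.card_neg] at h2
  exact h2

theorem upper {G : Type*} [AddCommGroup G] [DecidableEq G] (B : Finset G) (m : ℝ)
    (hm : ∀ x ∈ B, ∑ d ∈ B, ((stab B (d - x)).card : ℝ) ≤ m) :
    ∑ s ∈ B - B, ((stab B s).card : ℝ) * (addEnergy B (stab B s) : ℝ)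
      ≤ Real.sqrt m * (energyK 3 B : ℝ) := by
  have h1 : ∑ s ∈ B - B, ((stab B s).card : ℝ) * (addEnergy B (stab B s) : ℝ)
      = ∑ x ∈ B, ∑ d ∈ B, ∑ c ∈ B, (if c + (d - x) ∈ B then (1:ℝ) else 0) *
        (((stab B (d - x)).card : ℝ) * ((stab B (c - x)).card : ℝ)) := by
    rw [← sum_stab B (fun s x => ∑ c ∈ B, (if c + s ∈ B then (1:ℝ) else 0) *
        (((stab B s).card : ℝ) * ((stab B (c - x)).card : ℝ)))]
    apply Finset.sum_congr rfl
    intro s _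
    rw [energy_stab, Finset.mul_sum]
    apply Finset.sum_congr rfl
    intro x _
    rw [Finset.mul_sum]
    conv_lhs => rw [stab_eq_filter B s]
    rw [Finset.sum_filter]
    apply Finset.sum_congr rfl
    intro c _
    rw [← stab_neg_card B (x - c), neg_sub, ← stab_eq_filter]
    split_ifs <;> simp
  have h2 : (energyK 3 B : ℝ) = ∑ x ∈ B, ∑ d ∈ B, ((stab B (d - x)).card : ℝ) ^ 2 := by
    rw [sum_sub_eq B (fun s => ((stab B s).card : ℝ) ^ 2)]
    unfold energyK
    push_cast
    exact Finset.sum_congr rfl fun _ _ => by ring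
  rw [h1, h2, Finset.mul_sum]
  apply Finset.sum_le_sum
  intro x hx
  have hW : 0 ≤ ∑ d ∈ B, ((stab B (d - x)).card : ℝ) ^ 2 := by positivity
  refine le_trans ?_ (mul_le_mul_of_nonneg_right (Real.sqrt_le_sqrt (hm x hx)) hW)
  rw [← Finset.sum_product']
  refine (Real.sum_mul_le_sqrt_mul_sqrt _ _ _).trans (le_of_eq ?_)
  congr 1
  · congr 1
    rw [Finset.sum_product]
    apply Finset.sum_congr rfl
    intro d _
    rw [stab_eq_filter B (d - x)]
    simp
  · rw [Finset.sum_product]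
    have : ∑ d ∈ B, ∑ c ∈ B, (((stab B (d - x)).card : ℝ) * ((stab B (c - x)).card : ℝ)) ^ 2
      = (∑ d ∈ B, ((stab B (d - x)).card : ℝ) ^ 2) ^ 2 := by
      rw [sq (∑ d ∈ B, ((stab B (d - x)).card : ℝ) ^ 2), Finset.sum_mul_sum]
      simp only [mul_pow]
    simp only [this]
    exact Real.sqrt_sq hW

theorem lower {G : Type*} [AddCommGroup G] [DecidableEq G] (B : Finset G) (T : ℝ) (hT : 0 ≤ T)
    (h : ∀ s, s ≠ 0 → (B.card : ℝ) ^ 2 * ((stab B s).card : ℝ) ^ 2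
      ≤ T * (addEnergy B (stab B s) : ℝ)) :
    (B.card : ℝ) ^ 2 * ((energyK 3 B : ℝ) - (B.card : ℝ) ^ 3) ≤
      T * ∑ s ∈ B - B, ((stab B s).card : ℝ) * (addEnergy B (stab B s) : ℝ) := by
  have h0 : stab B 0 = B := by ext x; simp [mem_stab']
  have h1 : (energyK 3 B : ℝ) ≤
      ∑ s ∈ B - B, ((if s = 0 then (B.card : ℝ) ^ 3 else 0) +
        if s = 0 then 0 else ((stab B s).card : ℝ) ^ 3) := by
    unfold energyK
    push_cast
    apply Finset.sum_le_sum
    intro s _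
    split_ifs with hs
    · rw [hs, h0]; simp
    · simp
  have h2 : ∑ s ∈ B - B, (if s = 0 then (B.card : ℝ) ^ 3 else 0) ≤ (B.card : ℝ) ^ 3 := by
    rw [Finset.sum_ite_eq']
    split_ifs
    · exact le_rfl
    · positivity
  rw [Finset.sum_add_distrib] at h1
  have h3 : (energyK 3 B : ℝ) - (B.card : ℝ) ^ 3 ≤
      ∑ s ∈ B - B, if s = 0 then 0 else ((stab B s).card : ℝ) ^ 3 := by linarith
  refine (mul_le_mul_of_nonneg_left h3 (by positivity)).trans ?_
  rw [Finset.mul_sum, Finset.mul_sum]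
  apply Finset.sum_le_sum
  intro s _
  split_ifs with hs
  · rw [mul_zero]; positivity
  · have := mul_le_mul_of_nonneg_left (h s hs) (Nat.cast_nonneg (α := ℝ) (stab B s).card)
    nlinarith [this]

theorem markov {G : Type*} (A : Finset G) (f : G → ℝ) (hf : ∀ x, 0 ≤ f x) (m : ℝ) (hm : 0 < m)
    (h : ∑ x ∈ A, f x = m * ((A.card : ℝ) / 2)) :
    (A.card : ℝ) / 2 ≤ ((A.filter (fun x => f x ≤ m)).card : ℝ) := by
  have h1 : ∑ x ∈ A.filter (fun x => ¬ f x ≤ m), m ≤ ∑ x ∈ A, f x := by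
    refine le_trans (Finset.sum_le_sum (fun x hx => ?_))
      (Finset.sum_le_sum_of_subset_of_nonneg (Finset.filter_subset _ _) (fun x _ _ => hf x))
    exact (not_le.1 (Finset.mem_filter.1 hx).2).le
  rw [Finset.sum_const, nsmul_eq_mul, h] at h1
  have h2 : ((A.filter (fun x => f x ≤ m)).card : ℝ)
      + ((A.filter (fun x => ¬ f x ≤ m)).card : ℝ) = A.card := by
    exact_mod_cast Finset.card_filter_add_card_filter_not (s := A) _
  have h4 : ((A.filter (fun x => ¬ f x ≤ m)).card : ℝ) ≤ (A.card : ℝ) / 2 := by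
    rw [mul_comm] at h1
    exact le_of_mul_le_mul_left h1 hm
  linarith

set_option maxHeartbeats 1000000 in
theorem core {G : Type*} [AddCommGroup G] [DecidableEq G] (A : Finset G) (β γ K T : ℝ)
    (hA : A.Nonempty) (hK : K = (A.card : ℝ) ^ 3 / (energy A : ℝ))
    (hβ : β ≤ 1 / 2) (hγ : 0 < γ) (hγ1 : γ ≤ 1) (hc : conn 3 β γ A)
    (hE : 2 ^ 4 * γ⁻¹ * (A.card : ℝ) ^ 3 ≤ (energyK 3 A : ℝ))
    (hTdef : T = 1 / 16 * Real.sqrt γ * Real.sqrt K * (A.card : ℝ))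
    (h : ∀ B ⊆ A, ∀ s, s ≠ 0 → (B.card : ℝ) ^ 2 * ((stab B s).card : ℝ) ^ 2
      ≤ T * (addEnergy B (stab B s) : ℝ)) : False := by
  have hT : 0 ≤ T := by rw [hTdef]; positivity
  have ha : (0:ℝ) < A.card := by exact_mod_cast hA.card_pos
  set a : ℝ := (A.card : ℝ) with ha_def
  set E : ℝ := (energy A : ℝ) with hE_def
  have hEsum : ∑ x ∈ A, ∑ d ∈ A, ((stab A (d - x)).card : ℝ) = E := by
    rw [sum_sub_eq A (fun s => ((stab A s).card : ℝ)), hE_def]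
    unfold energy energyK
    push_cast
    exact Finset.sum_congr rfl fun _ _ => by ring
  have hEpos : 0 < E := by
    rw [← hEsum]
    apply Finset.sum_pos _ hA
    intro x hx
    apply Finset.sum_pos' (fun _ _ => by positivity)
    refine ⟨x, hx, ?_⟩
    have : 0 < (stab A (x - x)).card := Finset.card_pos.2 ⟨x, by rw [mem_stab']; simpa using hx⟩
    exact_mod_cast this
  set m : ℝ := 2 * E / a with hm_def
  have hmpos : 0 < m := by positivity
  set B := A.filter (fun x => ∑ d ∈ A, ((stab A (d - x)).card : ℝ) ≤ m) with hB_def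
  have hBA : B ⊆ A := Finset.filter_subset _ _
  -- Markov
  have hBcard : a / 2 ≤ (B.card : ℝ) := by
    have h3 : m * (a / 2) = E := by rw [hm_def]; field_simp
    exact markov A (fun x => ∑ d ∈ A, ((stab A (d - x)).card : ℝ))
      (fun x => Finset.sum_nonneg fun _ _ => Nat.cast_nonneg _) m hmpos
      (by rw [hEsum, ← h3])
  set b : ℝ := (B.card : ℝ) with hb_def
  have hb : 0 < b := by linarith
  have hE3 : 2 * b ^ 3 ≤ (energyK 3 B : ℝ) := by
    have h1 := hc B hBA (by rw [← ha_def, ← hb_def]; nlinarith)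
    rw [← ha_def, ← hb_def] at h1
    refine le_trans ?_ h1
    have h2 : γ * (b / a) ^ (2 * 3) * (2 ^ 4 * γ⁻¹ * a ^ 3) ≤ γ * (b / a) ^ (2 * 3) * (energyK 3 A : ℝ) :=
      mul_le_mul_of_nonneg_left hE (by positivity)
    refine le_trans ?_ h2
    have h3 : γ * (b / a) ^ (2 * 3) * (2 ^ 4 * γ⁻¹ * a ^ 3) = 16 * (b / a) ^ 3 * b ^ 3 := by
      rw [div_pow, div_pow]; field_simp; norm_num; ring
    rw [h3]
    have h4 : (1 / 2 : ℝ) ≤ b / a := by rw [le_div_iff₀ ha]; linarith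
    have h5 : (1 / 2 : ℝ) ^ 3 ≤ (b / a) ^ 3 := pow_le_pow_left₀ (by norm_num) h4 3
    have : 0 < b ^ 3 := by positivity
    nlinarith
  have hup := upper B m (by
    intro x hx
    refine le_trans ?_ (Finset.mem_filter.1 hx).2
    refine le_trans (Finset.sum_le_sum (g := fun d => ((stab A (d - x)).card : ℝ)) ?_)
      (Finset.sum_le_sum_of_subset_of_nonneg hBA (fun _ _ _ => by positivity))
    intro d _
    have : stab B (d - x) ⊆ stab A (d - x) := by
      intro y hy
      rw [mem_stab'] at hy ⊢
      exact ⟨hBA hy.1, hBA hy.2⟩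
    exact_mod_cast Finset.card_le_card this)
  have hlow := lower B T hT (h B hBA)
  rw [← hb_def] at hlow
  have hE3pos : (0:ℝ) < energyK 3 B := lt_of_lt_of_le (by positivity) hE3
  have hkey : b ^ 2 / 2 ≤ T * Real.sqrt m := by
    have h1 : T * ∑ s ∈ B - B, ((stab B s).card : ℝ) * (addEnergy B (stab B s) : ℝ)
      ≤ T * (Real.sqrt m * (energyK 3 B : ℝ)) := mul_le_mul_of_nonneg_left hup hT
    have h2 : b ^ 2 * ((energyK 3 B : ℝ) / 2) ≤ b ^ 2 * ((energyK 3 B : ℝ) - b ^ 3) :=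
      mul_le_mul_of_nonneg_left (by linarith) (by positivity)
    have h3 : (b ^ 2 / 2) * (energyK 3 B : ℝ) ≤ (T * Real.sqrt m) * (energyK 3 B : ℝ) := by
      linarith
    exact le_of_mul_le_mul_right h3 hE3pos
  have hKm : Real.sqrt K * Real.sqrt m = Real.sqrt 2 * a := by
    rw [← Real.sqrt_mul' _ hmpos.le, hK, hm_def]
    have : a ^ 3 / E * (2 * E / a) = 2 * a ^ 2 := by field_simp
    rw [this, Real.sqrt_mul (by norm_num), Real.sqrt_sq ha.le]
  have hTm : T * Real.sqrt m = 1 / 16 * Real.sqrt γ * Real.sqrt 2 * a ^ 2 := by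
    rw [hTdef]
    calc _ = 1 / 16 * Real.sqrt γ * a * (Real.sqrt K * Real.sqrt m) := by ring
      _ = _ := by rw [hKm]; ring
  have hg : Real.sqrt γ ≤ 1 := Real.sqrt_le_one.2 hγ1
  have h2 : Real.sqrt 2 < 3 / 2 := by
    rw [Real.sqrt_lt' (by norm_num)]; norm_num
  have hgg : Real.sqrt γ * Real.sqrt 2 ≤ 3 / 2 := by
    nlinarith [Real.sqrt_nonneg γ, Real.sqrt_nonneg 2]
  have hb2 : a ^ 2 / 4 ≤ b ^ 2 := by nlinarith
  have ha2 : 0 < a ^ 2 := by positivity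
  rw [hTm] at hkey
  nlinarith

theorem stmt_6 :
    ∃ c : ℝ, 0 < c ∧
      ∀ (G : Type u) [AddCommGroup G] [DecidableEq G] (A : Finset G) (β γ K : ℝ),
        A.Nonempty →
        K = (A.card : ℝ) ^ 3 / (energy A : ℝ) →
        0 < β → β ≤ 1 / 2 → 0 < γ → γ ≤ 1 →
        conn 3 β γ A →
        2 ^ 4 * γ⁻¹ * (A.card : ℝ) ^ 3 ≤ (energyK 3 A : ℝ) →
        (∃ x : G, x ≠ 0 ∧
            c * Real.sqrt γ * Real.sqrt K * (A.card : ℝ) ≤ ((stab (A - A) x).card : ℝ)) ∧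
        (∃ y : G, y ≠ 0 ∧
            c * Real.sqrt γ * Real.sqrt K * (A.card : ℝ) ≤ ((stab (A + A) y).card : ℝ)) := by
  refine ⟨1 / 16, by norm_num, ?_⟩
  intro G _ _ A β γ K hA hK _ hβ hγ hγ1 hc hE
  constructor
  · by_contra hcon
    push Not at hcon
    refine core A β γ K _ hA hK hβ hγ hγ1 hc hE rfl ?_
    intro B hBA s hs
    have h1 : ((B - stab B s).card : ℝ) ≤ ((stab (A - A) s).card : ℝ) := by
      have : (B - stab B s).card ≤ (stab (A - A) s).card := by
        apply Finset.card_le_card_of_injOn (fun d => d - s)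
        · intro d hd
          obtain ⟨x, hx, y, hy, rfl⟩ := Finset.mem_sub.1 hd
          rw [mem_stab'] at hy
          simp only [Finset.mem_coe]
          rw [mem_stab']
          refine ⟨?_, ?_⟩
          · rw [sub_sub]; exact sub_mem_sub (hBA hx) (hBA hy.2)
          · rw [sub_add_cancel]; exact sub_mem_sub (hBA hx) (hBA hy.1)
        · intro d _ e _ hde
          simpa using hde
      exact_mod_cast this
    have h2 : (B.card : ℝ) ^ 2 * ((stab B s).card : ℝ) ^ 2
        ≤ ((B - stab B s).card : ℝ) * (addEnergy B (stab B s) : ℝ) := sub_energy B (stab B s)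
    exact h2.trans (mul_le_mul_of_nonneg_right (h1.trans (hcon s hs).le) (by positivity))
  · by_contra hcon
    push Not at hcon
    refine core A β γ K _ hA hK hβ hγ hγ1 hc hE rfl ?_
    intro B hBA s hs
    have h1 : ((B + stab B s).card : ℝ) ≤ ((stab (A + A) s).card : ℝ) := by
      have : (B + stab B s) ⊆ stab (A + A) s := by
        intro d hd
        obtain ⟨x, hx, y, hy, rfl⟩ := Finset.mem_add.1 hd
        rw [mem_stab'] at hy ⊢
        refine ⟨add_mem_add (hBA hx) (hBA hy.1), ?_⟩
        rw [add_assoc]; exact add_mem_add (hBA hx) (hBA hy.2)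
      exact_mod_cast Finset.card_le_card this
    have h2 : (B.card : ℝ) ^ 2 * ((stab B s).card : ℝ) ^ 2
        ≤ ((B + stab B s).card : ℝ) * (addEnergy B (stab B s) : ℝ) := by
      exact_mod_cast Finset.le_card_add_mul_addEnergy B (stab B s)
    exact h2.trans (mul_le_mul_of_nonneg_right (h1.trans (hcon s hs).le) (by positivity))
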